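/- arXiv:0912.0418 — 2 statements merged into one kernel-verified Lean document; each statement's English description precedes it below -/
import Mathlib

section
/- Let g : ℝ³ → ℝ be integrable with g ≥ 0 almost everywhere, and let r > 0 satisfy ∫_{|y| > r} g(y) dy ≤ (1/4) ‖g‖₁, where ‖g‖₁ = ∫_{ℝ³} g(y) dy. Then for every p ∈ ℝ³ with |p| ≤ π/(3r), one has ∫_{ℝ³} g(y) cos(p·y) dy ≥ (1/8) ‖g‖₁. -/
open MeasureTheory
open scoped RealInnerProductSpace

/-- If `g ∈ L¹(ℝ³)` is a.e. nonnegative, `r > 0` and `∫_{|y|>r} g ≤ (1/4)‖g‖₁`, then for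
`|p| ≤ π/(3r)` we have `∫ g(y) cos(p·y) dy ≥ (1/8)‖g‖₁`. -/
theorem stmt_5 (g : EuclideanSpace ℝ (Fin 3) → ℝ) (hg : Integrable g)
    (hpos : ∀ᵐ y, 0 ≤ g y) (r : ℝ) (hr : 0 < r)
    (htail : ∫ y in {y : EuclideanSpace ℝ (Fin 3) | r < ‖y‖}, g y ≤ (1 / 4) * ∫ y, g y)
    (p : EuclideanSpace ℝ (Fin 3)) (hp : ‖p‖ ≤ Real.pi / (3 * r)) :
    (1 / 8) * ∫ y, g y ≤ ∫ y, g y * Real.cos ⟪p, y⟫ := by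
  set S := {y : EuclideanSpace ℝ (Fin 3) | r < ‖y‖}
  have hS : MeasurableSet S := measurableSet_lt measurable_const measurable_norm
  have cos_ge_half : ∀ y, ‖y‖ ≤ r → 1 / 2 ≤ Real.cos ⟪p, y⟫ := by
    intro y hy
    have hinner : |⟪p, y⟫| ≤ Real.pi / 3 :=
      calc |⟪p, y⟫| ≤ ‖p‖ * ‖y‖ := abs_real_inner_le_norm p y
        _ ≤ Real.pi / (3 * r) * r := by gcongr
        _ = Real.pi / 3 := by field_simp
    rw [← Real.cos_abs, ← Real.cos_pi_div_three]
    exact Real.cos_le_cos_of_nonneg_of_le_pi (abs_nonneg _)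
      (by linarith [Real.pi_pos]) hinner
  have hcos : Integrable fun y => g y * Real.cos ⟪p, y⟫ :=
    hg.mul_bdd (c := 1) (by fun_prop) (.of_forall fun y => Real.abs_cos_le_one _)
  have hlower : Integrable fun y => 1 / 2 * g y - 3 / 2 * S.indicator g y :=
    (hg.const_mul _).sub ((hg.indicator hS).const_mul _)
  calc (1 / 8) * ∫ y, g y ≤ 1 / 2 * (∫ y, g y) - 3 / 2 * ∫ y in S, g y := by linarith
    _ = ∫ y, (1 / 2 * g y - 3 / 2 * S.indicator g y) := by
      rw [integral_sub (hg.const_mul _) ((hg.indicator hS).const_mul _),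
        integral_const_mul, integral_const_mul, integral_indicator hS]
    _ ≤ ∫ y, g y * Real.cos ⟪p, y⟫ := by
      refine integral_mono_ae hlower hcos ?_
      filter_upwards [hpos] with y hy
      by_cases hyS : y ∈ S
      · rw [Set.indicator_of_mem hyS]
        nlinarith [Real.neg_one_le_cos ⟪p, y⟫]
      · rw [Set.indicator_of_notMem hyS]
        nlinarith [cos_ge_half y (not_lt.mp hyS)]
end

section
/- Let g : ℝ³ → ℝ be integrable with g ≥ 0 almost everywhere, let r > 0 satisfy ∫_{|y| > r} g(y) dy ≤ (1/4)‖g‖₁ where ‖g‖₁ = ∫ g, let ε₀ > 0, and set ε = min(ε₀, π/(3r)). Then for every z > 0, ∫_{|p| < ε} |∫_{ℝ³} e^{i p·y} g(y) dy|² / (|p|² + z²)^{3/2} dp ≥ (‖g‖₁²/64) ∫_{|p| < ε} (|p|² + z²)^{−3/2} dp. -/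
open MeasureTheory
open scoped RealInnerProductSpace

section FourierLowerBound

variable {E : Type*} [NormedAddCommGroup E] [InnerProductSpace ℝ E]

/-- If `|p| r ≤ π / 3`, then `cos (p · y) ≥ 1 / 2` on `|y| ≤ r`, and `cos (p · y) ≥ -1` elsewhere. -/
lemma half_sub_indicator_le_cos_inner {p : E} {r : ℝ} (hp : ‖p‖ * r ≤ Real.pi / 3) (y : E) :
    1 / 2 - 3 / 2 * {y : E | r < ‖y‖}.indicator 1 y ≤ Real.cos ⟪p, y⟫ := by
  by_cases hy : r < ‖y‖
  · rw [Set.indicator_of_mem (by exact hy), Pi.one_apply]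
    linarith [Real.neg_one_le_cos ⟪p, y⟫]
  · rw [Set.indicator_of_notMem (by exact hy), ← Real.cos_abs]
    have h : |⟪p, y⟫| ≤ Real.pi / 3 :=
      (abs_real_inner_le_norm p y).trans
        ((mul_le_mul_of_nonneg_left (not_lt.mp hy) (norm_nonneg p)).trans hp)
    have := Real.cos_le_cos_of_nonneg_of_le_pi (abs_nonneg _) (by linarith [Real.pi_pos]) h
    rw [Real.cos_pi_div_three] at this
    linarith

variable [MeasurableSpace E] [BorelSpace E] [SecondCountableTopology E] {μ : Measure E}
  {g : E → ℝ}

lemma integrable_exp_inner_mul (hg : Integrable g μ) (p : E) :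
    Integrable (fun y => Complex.exp (Complex.I * (⟪p, y⟫ : ℝ)) * (g y : ℂ)) μ := by
  refine hg.ofReal.bdd_mul (c := 1) (by fun_prop) (.of_forall fun y => ?_)
  rw [mul_comm, Complex.norm_exp_ofReal_mul_I]

lemma continuous_integral_exp_inner_mul (hg : Integrable g μ) :
    Continuous fun p : E => ∫ y, Complex.exp (Complex.I * (⟪p, y⟫ : ℝ)) * (g y : ℂ) ∂μ := by
  refine continuous_of_dominated (bound := fun y => ‖g y‖)
    (fun p => (integrable_exp_inner_mul hg p).aestronglyMeasurable)
    (fun p => .of_forall fun y => ?_) hg.norm (.of_forall fun y => by fun_prop)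
  rw [norm_mul, mul_comm Complex.I, Complex.norm_exp_ofReal_mul_I, one_mul, Complex.norm_real]

/-- A nonnegative function with at most a quarter of its mass outside the ball of radius `r` has
a Fourier transform bounded below by an eighth of its mass at frequencies `|p| ≤ π / (3r)`. -/
lemma integral_div_eight_le_norm_integral_exp_inner_mul (hg : Integrable g μ)
    (hpos : ∀ᵐ y ∂μ, 0 ≤ g y) {r : ℝ}
    (htail : ∫ y in {y : E | r < ‖y‖}, g y ∂μ ≤ (1 / 4) * ∫ y, g y ∂μ)
    {p : E} (hp : ‖p‖ * r ≤ Real.pi / 3) :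
    (∫ y, g y ∂μ) / 8 ≤ ‖∫ y, Complex.exp (Complex.I * (⟪p, y⟫ : ℝ)) * (g y : ℂ) ∂μ‖ := by
  have hs : MeasurableSet {y : E | r < ‖y‖} := measurableSet_lt measurable_const measurable_norm
  have hre : ∀ y, (Complex.exp (Complex.I * (⟪p, y⟫ : ℝ)) * (g y : ℂ)).re
      = Real.cos ⟪p, y⟫ * g y := fun y => by
    rw [Complex.re_mul_ofReal, mul_comm Complex.I, Complex.exp_ofReal_mul_I_re]
  have hint := integrable_exp_inner_mul hg p
  have hcos : Integrable (fun y => Real.cos ⟪p, y⟫ * g y) μ := by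
    simpa only [RCLike.re_to_complex, hre] using hint.re
  have htailint := (hg.indicator hs).const_mul (3 / 2)
  calc (∫ y, g y ∂μ) / 8
      ≤ 1 / 2 * ∫ y, g y ∂μ - 3 / 2 * ∫ y in {y : E | r < ‖y‖}, g y ∂μ := by linarith
    _ = ∫ y, (1 / 2 * g y - 3 / 2 * {y : E | r < ‖y‖}.indicator g y) ∂μ := by
        rw [integral_sub (hg.const_mul _) htailint, integral_const_mul, integral_const_mul,
          integral_indicator hs]
    _ ≤ ∫ y, Real.cos ⟪p, y⟫ * g y ∂μ := by
        refine integral_mono_ae ((hg.const_mul _).sub htailint) hcos ?_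
        filter_upwards [hpos] with y hy
        have h := mul_le_mul_of_nonneg_right (half_sub_indicator_le_cos_inner hp y) hy
        have hind : {y : E | r < ‖y‖}.indicator g y = {y : E | r < ‖y‖}.indicator 1 y * g y := by
          by_cases hy : y ∈ {y : E | r < ‖y‖} <;> simp [hy]
        rw [hind]
        linarith
    _ = (∫ y, Complex.exp (Complex.I * (⟪p, y⟫ : ℝ)) * (g y : ℂ) ∂μ).re := by
        rw [← RCLike.re_to_complex, ← integral_re hint]
        simp only [RCLike.re_to_complex, hre]
    _ ≤ _ := Complex.re_le_norm _

end FourierLowerBound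

/-- With `g ∈ L¹(ℝ³)` a.e. nonnegative, `r > 0` such that `∫_{|y|>r} g ≤ (1/4)‖g‖₁`,
`ε = min ε₀ (π/(3r))` and `z > 0`, one has
`∫_{|p|<ε} |ĝ(p)|²/(|p|²+z²)^{3/2} dp ≥ (‖g‖₁²/64) ∫_{|p|<ε} (|p|²+z²)^{-3/2} dp`. -/
theorem stmt_8 (g : EuclideanSpace ℝ (Fin 3) → ℝ) (hg : Integrable g)
    (hpos : ∀ᵐ y, 0 ≤ g y) (r : ℝ) (hr : 0 < r)
    (htail : ∫ y in {y : EuclideanSpace ℝ (Fin 3) | r < ‖y‖}, g y ≤ (1 / 4) * ∫ y, g y)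
    (ε₀ : ℝ) (hε₀ : 0 < ε₀) (z : ℝ) (hz : 0 < z) :
    ((∫ y, g y) ^ 2 / 64) *
        ∫ p in {p : EuclideanSpace ℝ (Fin 3) | ‖p‖ < min ε₀ (Real.pi / (3 * r))},
          ((‖p‖ ^ 2 + z ^ 2) ^ (3 / 2 : ℝ))⁻¹
      ≤ ∫ p in {p : EuclideanSpace ℝ (Fin 3) | ‖p‖ < min ε₀ (Real.pi / (3 * r))},
          ‖∫ y, Complex.exp (Complex.I * (⟪p, y⟫ : ℝ)) * (g y : ℂ)‖ ^ 2 /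
            (‖p‖ ^ 2 + z ^ 2) ^ (3 / 2 : ℝ) := by
  have hden : ∀ p : EuclideanSpace ℝ (Fin 3), 0 < ‖p‖ ^ 2 + z ^ 2 := fun p => by positivity
  have hdenpow : ∀ p : EuclideanSpace ℝ (Fin 3), (‖p‖ ^ 2 + z ^ 2) ^ (3 / 2 : ℝ) ≠ 0 :=
    fun p => (Real.rpow_pos_of_pos (hden p) _).ne'
  have hdencont : Continuous fun p : EuclideanSpace ℝ (Fin 3) =>
      (‖p‖ ^ 2 + z ^ 2) ^ (3 / 2 : ℝ) :=
    Continuous.rpow_const (by fun_prop) fun p => Or.inl (hden p).ne'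
  have hball : {p : EuclideanSpace ℝ (Fin 3) | ‖p‖ < min ε₀ (Real.pi / (3 * r))}
      ⊆ Metric.closedBall 0 (min ε₀ (Real.pi / (3 * r))) := fun p hp => by
    simpa using le_of_lt (show ‖p‖ < _ from hp)
  have hintegrable : ∀ f : EuclideanSpace ℝ (Fin 3) → ℝ, Continuous f →
      IntegrableOn f {p | ‖p‖ < min ε₀ (Real.pi / (3 * r))} := fun f hf =>
    (hf.continuousOn.integrableOn_compact (isCompact_closedBall 0 _)).mono_set hball
  rw [← integral_const_mul]
  refine setIntegral_mono_on (hintegrable _ (continuous_const.mul (hdencont.inv₀ hdenpow)))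
    (hintegrable _ (((continuous_integral_exp_inner_mul hg).norm.pow 2).div hdencont hdenpow))
    (measurableSet_lt measurable_norm measurable_const) fun p hp => ?_
  have hpr : ‖p‖ * r ≤ Real.pi / 3 := by
    have h : ‖p‖ ≤ Real.pi / (3 * r) := (lt_min_iff.mp hp).2.le
    rw [le_div_iff₀ (by positivity)] at h
    linarith
  have h := integral_div_eight_le_norm_integral_exp_inner_mul hg hpos htail hpr
  have h0 : 0 ≤ ∫ y, g y := integral_nonneg_of_ae hpos
  rw [← div_eq_mul_inv]
  refine div_le_div_of_nonneg_right ?_ (Real.rpow_nonneg (hden p).le _)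
  calc (∫ y, g y) ^ 2 / 64 = ((∫ y, g y) / 8) ^ 2 := by ring
    _ ≤ _ := pow_le_pow_left₀ (by positivity) h 2
end
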